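/- arXiv:2110.15522 — 3 statements merged into one kernel-verified Lean document; each statement's English description precedes it below -/
import Mathlib

section
/- Let C be a positive natural number, let b : Fin C → ℝ, let ε > 0, and let β : (0,1) → ℝ be a differentiable function satisfying ∑_{c} 1/(1 + exp(−(b c − β(α))/ε)) = α·C for all α ∈ (0,1). For α ∈ (0,1) set p_c = 1/(1 + exp(−(b c − β(α))/ε)). Then the derivative of β at α equals β'(α) = −ε·C / (∑_{c} p_c·(1 − p_c)). -/
theorem stmt_8 (C : ℕ) (hC : 0 < C) (b : Fin C → ℝ) (ε : ℝ) (hε : 0 < ε)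
    (β : ℝ → ℝ)
    (hdiff : ∀ α ∈ Set.Ioo (0 : ℝ) 1, DifferentiableAt ℝ β α)
    (hβ : ∀ α ∈ Set.Ioo (0 : ℝ) 1,
      (∑ c, 1 / (1 + Real.exp (-(b c - β α) / ε))) = α * C)
    (α : ℝ) (hα : α ∈ Set.Ioo (0 : ℝ) 1)
    (p : Fin C → ℝ)
    (hp : ∀ c, p c = 1 / (1 + Real.exp (-(b c - β α) / ε))) :
    deriv β α = -(ε * C) / (∑ c, p c * (1 - p c)) := by
  have hd := (hdiff α hα).hasDerivAt
  have h1 : ∀ c ∈ (Finset.univ : Finset (Fin C)),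
      HasDerivAt (fun a => 1 / (1 + Real.exp (-(b c - β a) / ε)))
        (-(deriv β α / ε) * (p c * (1 - p c))) α := by
    intro c _
    have hpos : 1 + Real.exp (-(b c - β α) / ε) ≠ 0 := by positivity
    have h := ((((hd.const_sub (b c)).neg.div_const ε).exp.const_add 1).inv hpos)
    simp only [one_div]
    refine h.congr_deriv ?_
    rw [hp c]
    simp only [Pi.neg_apply]
    field_simp
    ring
  have h2 := HasDerivAt.fun_sum h1
  have h3 : HasDerivAt (fun a : ℝ => a * (C : ℝ)) (1 * (C : ℝ)) α :=
    (hasDerivAt_id α).mul_const (C : ℝ)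
  have h4 : (fun a => ∑ c, 1 / (1 + Real.exp (-(b c - β a) / ε)))
      =ᶠ[nhds α] (fun a : ℝ => a * (C : ℝ)) := by
    filter_upwards [isOpen_Ioo.mem_nhds hα] with a ha using hβ a ha
  have h5 := h2.unique (h3.congr_of_eventuallyEq h4)
  rw [← Finset.mul_sum, one_mul] at h5
  have hS : (∑ c, p c * (1 - p c)) ≠ 0 := by
    intro h0
    rw [h0, mul_zero] at h5
    have : (0 : ℝ) < C := by exact_mod_cast hC
    linarith
  rw [eq_div_iff hS, ← h5]
  field_simp
end

section
/- Let C be a positive natural number, let b : Fin C → ℝ, let ε > 0, and let β : (0,1) → ℝ be a differentiable function satisfying ∑_{c} 1/(1 + exp(−(b c − β(α))/ε)) = α·C for all α ∈ (0,1). Define p : (0,1) → ℝ^C by p(α)_c = 1/(1 + exp(−(b c − β(α))/ε)), and let L : ℝ^C → ℝ be differentiable. Then for every α ∈ (0,1), the derivative of the composite α ↦ L(p(α)) equals C · ∑_{c} (∂L/∂p_c)(p(α)) · p(α)_c·(1 − p(α)_c) / (∑_{c} p(α)_c·(1 − p(α)_c)). -/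
theorem stmt_9 (C : ℕ) (hC : 0 < C) (b : Fin C → ℝ) (ε : ℝ) (hε : 0 < ε)
    (β : ℝ → ℝ)
    (hdiff : ∀ α ∈ Set.Ioo (0 : ℝ) 1, DifferentiableAt ℝ β α)
    (hβ : ∀ α ∈ Set.Ioo (0 : ℝ) 1,
      (∑ c, 1 / (1 + Real.exp (-(b c - β α) / ε))) = α * C)
    (p : ℝ → Fin C → ℝ)
    (hp : ∀ α c, p α c = 1 / (1 + Real.exp (-(b c - β α) / ε)))
    (L : (Fin C → ℝ) → ℝ) (hL : Differentiable ℝ L)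
    (α : ℝ) (hα : α ∈ Set.Ioo (0 : ℝ) 1) :
    deriv (fun a => L (p a)) α =
      (C : ℝ) * ∑ c, fderiv ℝ L (p α) (Pi.single c 1) *
        (p α c * (1 - p α c)) / (∑ c', p α c' * (1 - p α c')) := by
  have hpd : ∀ c, HasDerivAt (fun a => p a c)
      ((p α c * (1 - p α c)) * (-(deriv β α) / ε)) α := by
    intro c
    have h1 : HasDerivAt (fun a => -(b c - β a) / ε) (deriv β α / ε) α := by
      have h := (((hdiff α hα).hasDerivAt.const_sub (b c)).neg).div_const ε
      rw [neg_neg] at h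
      exact h
    have hpos : 0 < Real.exp (-(b c - β α) / ε) := Real.exp_pos _
    have h2 := (h1.exp.const_add 1).inv (by positivity)
    have hfun : (fun a => p a c) = (fun a => 1 + Real.exp (-(b c - β a) / ε))⁻¹ := by
      funext a
      simp [hp]
    rw [hfun]
    refine h2.congr_deriv ?_
    rw [hp]
    generalize Real.exp (-(b c - β α) / ε) = x at hpos
    have hx : 1 + x ≠ 0 := by positivity
    field_simp
    ring
  set k := -(deriv β α) / ε with hk
  set S := ∑ c', p α c' * (1 - p α c') with hS
  have hsum : HasDerivAt (fun a => ∑ c, p a c) (∑ c, (p α c * (1 - p α c)) * k) α :=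
    HasDerivAt.fun_sum fun c _ => hpd c
  have hsum' : HasDerivAt (fun a => ∑ c, p a c) (C : ℝ) α := by
    have h : HasDerivAt (fun a : ℝ => a * (C : ℝ)) (C : ℝ) α := by
      simpa using (hasDerivAt_id α).mul_const (C : ℝ)
    refine h.congr_of_eventuallyEq ?_
    filter_upwards [isOpen_Ioo.mem_nhds hα] with a ha
    rw [← hβ a ha]
    simp only [hp]
  have hSk : S * k = C := by
    rw [hS, Finset.sum_mul]
    exact hsum.unique hsum'
  have hC' : (C : ℝ) ≠ 0 := by exact_mod_cast hC.ne'
  have hS0 : S ≠ 0 := by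
    intro h
    rw [h, zero_mul] at hSk
    exact hC' hSk.symm
  have hpv : HasDerivAt p (fun c => (p α c * (1 - p α c)) * k) α :=
    hasDerivAt_pi.2 hpd
  have hcomp := (hL (p α)).hasFDerivAt.comp_hasDerivAt α hpv
  have hd : deriv (fun a => L (p a)) α = _ := hcomp.deriv
  rw [hd, ← hSk, Finset.mul_sum]
  conv_lhs => rw [← Finset.univ_sum_single (fun c => (p α c * (1 - p α c)) * k)]
  rw [map_sum]
  refine Finset.sum_congr rfl fun c _ => ?_
  have : (Pi.single c ((p α c * (1 - p α c)) * k) : Fin C → ℝ)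
      = ((p α c * (1 - p α c)) * k) • Pi.single c (1 : ℝ) := by
    rw [← Pi.single_smul]; simp
  rw [this, map_smul, smul_eq_mul]
  field_simp
end

section
/- Let m and n be natural numbers, let a : Fin m → ℝ, w : Fin m → Fin n → ℝ, and R' : Fin n → ℝ. Assume that for every j, the denominator D_j = ∑_{i'} max(a i' * w i' j, 0) is strictly positive. Define R : Fin m → ℝ by R i = ∑_{j} (max(a i * w i j, 0) / D_j) · R' j. Then ∑_{i} R i = ∑_{j} R' j. -/
theorem stmt_12 (m n : ℕ) (a : Fin m → ℝ) (w : Fin m → Fin n → ℝ) (R' : Fin n → ℝ)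
    (hD : ∀ j, 0 < ∑ i', max (a i' * w i' j) 0)
    (R : Fin m → ℝ)
    (hR : ∀ i, R i = ∑ j,
      (max (a i * w i j) 0 / ∑ i', max (a i' * w i' j) 0) * R' j) :
    (∑ i, R i) = ∑ j, R' j := by
  simp only [hR]
  rw [Finset.sum_comm]
  refine Finset.sum_congr rfl fun j _ => ?_
  rw [← Finset.sum_mul, ← Finset.sum_div, div_self (hD j).ne', one_mul]
end
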